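/- (Separation of variables for the rational case.) Let A be a Poisson algebra over ℂ, η ∈ ℂ, and let a, b, c ∈ A[X] satisfy: {a_i, a_j} = 0 and {b_i, b_j} = 0 for all coefficients, and (λ−μ)·{a(λ), b(μ)} = η·(b(μ) − b(λ)) as an identity in A[λ,μ]. Let u, w ∈ A be two roots of b (b(u) = b(w) = 0) with b'(u), b'(w) invertible, and assume u − w is invertible. Set v = a(u) and v' = a(w). Then (u, v) and (w, v') are canonically conjugate separation variables: {u, w} = 0, {v, u} = η, {v, w} = 0, {v', u} = 0, {v, v'} = 0; moreover the separation equations hold: v² = −d(u) and v'² = −d(w), where d = −(a² + b·c) ∈ A[X] is the determinant polynomial of the Lax matrix L = [[a, b],[c, −a]]. -/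

import Mathlib

open Polynomial

/-- A Poisson algebra over ℂ. -/
structure PoissonC (A : Type*) [CommRing A] [Algebra ℂ A] where
  br : A → A → A
  add_left : ∀ x y z : A, br (x + y) z = br x z + br y z
  add_right : ∀ x y z : A, br x (y + z) = br x y + br x z
  antisymm : ∀ x y : A, br x y = - br y x
  jacobi : ∀ x y z : A, br x (br y z) + br y (br z x) + br z (br x y) = 0
  leibniz : ∀ x y z : A, br x (y * z) = br x y * z + y * br x z
  scalar : ∀ (c : ℂ) (x : A), br (algebraMap ℂ A c) x = 0

variable {A : Type*} [CommRing A] [Algebra ℂ A]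

/-- The two-variable bracket `{p(λ), q(μ)} = Σ_{i,j} {p_i, q_j} λ^i μ^j ∈ A[λ,μ] = (A[μ])[λ]`
(outer variable `λ`, inner variable `μ`). -/
noncomputable def br2 (P : PoissonC A) (p q : Polynomial A) :
    Polynomial (Polynomial A) :=
  ∑ i ∈ p.support, ∑ j ∈ q.support,
    Polynomial.C (Polynomial.C (P.br (p.coeff i) (q.coeff j)) * Polynomial.X ^ j)
      * Polynomial.X ^ i

namespace PoissonC

theorem br_eq_zero_symm (P : PoissonC A) {x y : A} (h : P.br x y = 0) : P.br y x = 0 := by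
  rw [P.antisymm, h, neg_zero]

theorem br_self (P : PoissonC A) (x : A) : P.br x x = 0 := by
  have h : (2 : ℂ) • P.br x x = 0 := by
    rw [two_smul]
    exact eq_neg_iff_add_eq_zero.mp (P.antisymm x x)
  simpa using h

/-- The Hamiltonian derivation `{x, ·}`. -/
def ad (P : PoissonC A) (x : A) : Derivation ℂ A A :=
  Derivation.mk'
    { toFun := P.br x
      map_add' := P.add_right x
      map_smul' := fun r y => by
        rw [Algebra.smul_def, P.leibniz, P.br_eq_zero_symm (P.scalar r x)]
        simp [Algebra.smul_def] }
    (fun y z => by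
      simp only [LinearMap.coe_mk, AddHom.coe_mk, P.leibniz, smul_eq_mul]
      ring)

theorem ad_apply (P : PoissonC A) (x y : A) : P.ad x y = P.br x y := rfl

/-- Chain rule for the bracket with the value of a polynomial. -/
theorem br_eval (P : PoissonC A) (x : A) (p : Polynomial A) (u : A) :
    P.br x (p.eval u) =
      ∑ i ∈ p.support, P.br x (p.coeff i) * u ^ i + (derivative p).eval u * P.br x u := by
  rw [eval_eq_sum, derivative_eval, Polynomial.sum, Polynomial.sum, ← ad_apply, map_sum,
    Finset.sum_mul, ← Finset.sum_add_distrib]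
  refine Finset.sum_congr rfl fun i _ => ?_
  simp only [Derivation.leibniz, Derivation.leibniz_pow, ad_apply, smul_eq_mul, nsmul_eq_mul]
  ring

/-- If `u` is a simple root of `b`, the bracket of `u` with `x` is governed by the
coefficients of `b`. -/
theorem br_root (P : PoissonC A) {b : Polynomial A} {u : A} (hu : b.eval u = 0) (x : A) :
    (derivative b).eval u * P.br x u = -∑ j ∈ b.support, P.br x (b.coeff j) * u ^ j := by
  have h := P.br_eval x b u
  rw [hu, ← ad_apply, map_zero] at h
  linear_combination -h

theorem br_root_eq_zero (P : PoissonC A) {b : Polynomial A} {u : A} (hu : b.eval u = 0)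
    (hu' : IsUnit ((derivative b).eval u)) {x : A} (hx : ∀ j, P.br x (b.coeff j) = 0) :
    P.br x u = 0 := by
  refine hu'.mul_right_eq_zero.mp ?_
  simp [P.br_root hu, hx]

theorem evalEval_br2 (P : PoissonC A) (p q : Polynomial A) (x y : A) :
    (br2 P p q).evalEval x y =
      ∑ i ∈ p.support, (∑ j ∈ q.support, P.br (p.coeff i) (q.coeff j) * x ^ j) * y ^ i := by
  simp [br2, evalEval, eval_finsetSum, Finset.sum_mul]

/-- Contracting the brackets of the coefficients of `p` with a root `u` of `q`. -/
theorem derivative_mul_sum_br_root (P : PoissonC A) (p : Polynomial A) {q : Polynomial A} {u : A}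
    (hu : q.eval u = 0) (y : A) :
    (derivative q).eval u * ∑ i ∈ p.support, P.br (p.coeff i) u * y ^ i =
      -(br2 P p q).evalEval u y := by
  rw [evalEval_br2, Finset.mul_sum, ← Finset.sum_neg_distrib]
  refine Finset.sum_congr rfl fun i _ => ?_
  rw [← mul_assoc, P.br_root hu, neg_mul]

/-- Bracket of the value of a polynomial with a fixed element. -/
theorem eval_br (P : PoissonC A) (p : Polynomial A) (y x : A) :
    P.br (p.eval y) x =
      ∑ i ∈ p.support, P.br (p.coeff i) x * y ^ i + (derivative p).eval y * P.br y x := by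
  rw [P.antisymm, br_eval, P.antisymm x y]
  simp_rw [fun i => P.antisymm x (p.coeff i), neg_mul, Finset.sum_neg_distrib]
  ring

end PoissonC

theorem evalEval_self_of_sub_mul_eq {F : Polynomial (Polynomial A)} {b : Polynomial A} {η : ℂ}
    (h : (X - C X) * F = algebraMap ℂ (Polynomial (Polynomial A)) η * (C b - b.map C)) (x : A) :
    F.evalEval x x = -(algebraMap ℂ A η * (derivative b).eval x) := by
  have h' := congrArg (fun G => (derivative G).evalEval x x) h
  simpa [IsScalarTower.algebraMap_apply ℂ A (Polynomial (Polynomial A)), Polynomial.algebraMap_apply,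
    derivative_map, evalEval, eval_map] using h'

theorem evalEval_of_sub_mul_eq {F : Polynomial (Polynomial A)} {b : Polynomial A} {η : ℂ}
    (h : (X - C X) * F = algebraMap ℂ (Polynomial (Polynomial A)) η * (C b - b.map C)) (x y : A) :
    (y - x) * F.evalEval x y = algebraMap ℂ A η * (b.eval x - b.eval y) := by
  have h' := congrArg (evalEval x y) h
  simpa [IsScalarTower.algebraMap_apply ℂ A (Polynomial (Polynomial A)), Polynomial.algebraMap_apply,
    evalEval, eval_map] using h'

/-- separation of variables in the rational case: roots of `b` and values of
`a` at those roots are canonically conjugate variables and satisfy the separation equations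
`v² = −d(u)`, `v'² = −d(w)` for the determinant polynomial `d = −(a² + b·c)`. -/
theorem statement10 (P : PoissonC A) (η : ℂ) (a b c : Polynomial A)
    (haa : ∀ i j, P.br (a.coeff i) (a.coeff j) = 0)
    (hbb : ∀ i j, P.br (b.coeff i) (b.coeff j) = 0)
    (hab : (Polynomial.X - Polynomial.C Polynomial.X) * br2 P a b
      = algebraMap ℂ (Polynomial (Polynomial A)) η
          * (Polynomial.C b - b.map Polynomial.C))
    (u w : A) (hu : b.eval u = 0) (hw : b.eval w = 0)
    (hu' : IsUnit ((Polynomial.derivative b).eval u))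
    (hw' : IsUnit ((Polynomial.derivative b).eval w))
    (huw : IsUnit (u - w))
    (v v' : A) (hv : v = a.eval u) (hv' : v' = a.eval w)
    (d : Polynomial A) (hd : d = -(a ^ 2 + b * c)) :
    P.br u w = 0 ∧
    P.br v u = algebraMap ℂ A η ∧
    P.br v w = 0 ∧
    P.br v' u = 0 ∧
    P.br v v' = 0 ∧
    v ^ 2 = -(d.eval u) ∧
    v' ^ 2 = -(d.eval w) := by
  subst hv hv' hd
  have hbu (i : ℕ) : P.br u (b.coeff i) = 0 :=
    P.br_eq_zero_symm (P.br_root_eq_zero hu hu' (hbb i))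
  have huw0 : P.br u w = 0 := P.br_root_eq_zero hw hw' hbu
  have sum_uu : ∑ i ∈ a.support, P.br (a.coeff i) u * u ^ i = algebraMap ℂ A η := by
    refine hu'.mul_left_cancel ?_
    rw [P.derivative_mul_sum_br_root a hu, evalEval_self_of_sub_mul_eq hab]
    ring
  have sum_eq_zero {x y : A} (hx : b.eval x = 0) (hx' : IsUnit ((derivative b).eval x))
      (hy : b.eval y = 0) (hyx : IsUnit (y - x)) :
      ∑ i ∈ a.support, P.br (a.coeff i) x * y ^ i = 0 := by
    have h : (br2 P a b).evalEval x y = 0 := by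
      refine hyx.mul_right_eq_zero.mp ?_
      rw [evalEval_of_sub_mul_eq hab, hx, hy, sub_zero, mul_zero]
    refine hx'.mul_right_eq_zero.mp ?_
    rw [P.derivative_mul_sum_br_root a hx, h, neg_zero]
  have hwu : IsUnit (w - u) := by simpa using huw.neg
  have hvw : P.br (a.eval u) w = 0 := by
    rw [P.eval_br, sum_eq_zero hw hw' hu huw, huw0, mul_zero, add_zero]
  have hav (i : ℕ) : P.br (a.coeff i) (a.eval u) =
      (derivative a).eval u * P.br (a.coeff i) u := by
    simp [P.br_eval, haa]
  refine ⟨huw0, ?_, hvw, ?_, ?_, ?_, ?_⟩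
  · rw [P.eval_br, sum_uu, P.br_self, mul_zero, add_zero]
  · rw [P.eval_br, sum_eq_zero hu hu' hw hwu, P.br_eq_zero_symm huw0, mul_zero, add_zero]
  · refine P.br_eq_zero_symm ?_
    rw [P.eval_br, P.br_eq_zero_symm hvw, mul_zero, add_zero]
    simp_rw [hav, mul_assoc]
    rw [← Finset.mul_sum, sum_eq_zero hu hu' hw hwu, mul_zero]
  · simp [hu]
  · simp [hw]
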